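/- Let σ > 1 and define φ₀ : (0, 2π) → ℝ by φ₀(x) = exp(−(log(8π/x))^σ − (log(8π/(2π−x)))^σ). Then there exists a constant C > 0 such that for every n ∈ ℕ, sup_{x∈(0,2π)} |φ₀^{(n)}(x)| ≤ exp(C·n^{σ/(σ−1)}). In particular, the 2π-periodic extension of φ₀ (with φ₀(0) = 0) is a C^∞ function on ℝ all of whose derivatives vanish at 0. -/

import Mathlib

noncomputable section

open Real

/-- Uniform control of the complexified power of the logarithm on small discs. -/
lemma s15_key (σ : ℝ) : ∃ c : ℝ, 0 < c ∧ c ≤ 1/2 ∧ ∀ x : ℝ, 0 < x → x < 2 * π →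
    ∀ z : ℂ, ‖z - x‖ ≤ c * x →
      z ≠ 0 ∧ (8 * π / z : ℂ) ∈ Complex.slitPlane ∧
      Complex.log (8 * π / z : ℂ) ∈ Complex.slitPlane ∧
      (Real.log (8 * π / x)) ^ σ / 2 ≤ ((Complex.log (8 * π / z : ℂ)) ^ (σ : ℂ)).re := by
  have h1 : ∀ᶠ w : ℂ in nhds 1, 1/2 < (w ^ (σ : ℂ)).re := by
    have hc : ContinuousAt (fun w : ℂ => (w ^ (σ : ℂ)).re) 1 := by
      apply Complex.continuous_re.continuousAt.comp
      exact (differentiableAt_id.cpow_const (by simp)).continuousAt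
    apply hc.eventually_const_lt
    simp; norm_num
  obtain ⟨δ, hδ, h1⟩ := Metric.eventually_nhds_iff.1 h1
  have h2 : ∀ᶠ v : ℂ in nhds 1, ‖Complex.log v⁻¹‖ < min δ (1/2) := by
    have hc : ContinuousAt (fun v : ℂ => ‖Complex.log v⁻¹‖) 1 := by
      apply ContinuousAt.norm
      apply ContinuousAt.clog
      · exact continuousAt_inv₀ one_ne_zero
      · simp
    apply hc.eventually_lt_const
    simp [hδ]
  obtain ⟨ε, hε, h2⟩ := Metric.eventually_nhds_iff.1 h2
  refine ⟨min (ε/2) (1/2), by positivity, min_le_right _ _, ?_⟩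
  intro x hx hx2 z hz
  have hpi := Real.pi_pos
  have hx0 : (x : ℂ) ≠ 0 := by exact_mod_cast hx.ne'
  have hzre : 0 < z.re := by
    have a1 : |(z - x).re| ≤ 1/2 * x :=
      (Complex.abs_re_le_norm _).trans (hz.trans (by gcongr; exact min_le_right _ _))
    have a2 := (abs_le.1 a1).1
    simp at a2
    linarith
  have hz0 : z ≠ 0 := by rintro rfl; simp at hzre
  set L := Real.log (8 * π / x) with hL
  have hL1 : 1 < L := by
    rw [hL, Real.lt_log_iff_exp_lt (by positivity), lt_div_iff₀ hx]
    have := Real.exp_one_lt_d9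
    nlinarith
  set v : ℂ := z / x with hv
  have hv0 : v ≠ 0 := div_ne_zero hz0 hx0
  have hv1 : ‖Complex.log v⁻¹‖ < min δ (1/2) := by
    apply h2
    rw [dist_eq_norm, hv, show z / x - 1 = (z - x) / x by field_simp, norm_div, Complex.norm_real,
      Real.norm_of_nonneg hx.le, div_lt_iff₀ hx]
    apply hz.trans_lt
    have : min (ε/2) (1/2) < ε := (min_le_left _ _).trans_lt (by linarith)
    gcongr
  have hLc : (L : ℂ) ≠ 0 := by exact_mod_cast (by linarith : L ≠ 0)
  set u : ℂ := Complex.log v⁻¹ / L with hu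
  have hun : ‖u‖ < min δ (1/2) := by
    rw [hu, norm_div, Complex.norm_real, Real.norm_of_nonneg (by linarith)]
    apply lt_of_le_of_lt _ hv1
    exact div_le_self (norm_nonneg _) hL1.le
  have hure : 0 < (1 + u).re := by
    have := (abs_le.1 (Complex.abs_re_le_norm u)).1
    have := hun.trans_le (min_le_right _ _)
    simp
    linarith
  have hlog : Complex.log (8 * π / z : ℂ) = L * (1 + u) := by
    rw [show (8 * π / z : ℂ) = ((8 * π / x : ℝ) : ℂ) * v⁻¹ by rw [hv]; push_cast; field_simp,
      Complex.log_ofReal_mul (by positivity) (inv_ne_zero hv0), ← hL, hu]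
    field_simp
  have hu0 : 1 + u ≠ 0 := by intro h; simp [h] at hure
  refine ⟨hz0, ?_, ?_, ?_⟩
  · left
    rw [div_eq_mul_inv, show (8 * π : ℂ) = ((8 * π : ℝ) : ℂ) by push_cast; rfl,
      Complex.re_ofReal_mul, Complex.inv_re]
    have := Complex.normSq_pos.2 hz0
    positivity
  · left
    rw [hlog, Complex.re_ofReal_mul]
    have : 0 < L := by linarith
    positivity
  · have hpow : (Complex.log (8 * π / z : ℂ)) ^ (σ : ℂ) = ((L ^ σ : ℝ) : ℂ) * (1 + u) ^ (σ : ℂ) := by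
      rw [hlog, Complex.cpow_def_of_ne_zero (mul_ne_zero hLc hu0),
        Complex.log_ofReal_mul (by linarith) hu0, Complex.ofReal_cpow (by linarith),
        Complex.cpow_def_of_ne_zero hLc, Complex.cpow_def_of_ne_zero hu0, ← Complex.exp_add,
        Complex.ofReal_log (by linarith), add_mul]
    rw [hpow, Complex.re_ofReal_mul]
    have h3 : 1/2 < ((1 + u) ^ (σ : ℂ)).re := by
      apply h1
      rw [dist_eq_norm]
      simpa using hun.trans_le (min_le_left _ _)
    have : 0 ≤ L ^ σ := by positivity
    nlinarith

/-- The holomorphic extension. -/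
def s15F (σ : ℝ) (z : ℂ) : ℂ :=
  Complex.exp (-(Complex.log (8 * π / z)) ^ (σ : ℂ) - (Complex.log (8 * π / (2 * π - z))) ^ (σ : ℂ))

lemma s15_logpos {x : ℝ} (hx : 0 < x) (hx2 : x < 2 * π) : 0 ≤ Real.log (8 * π / x) := by
  apply Real.log_nonneg
  rw [le_div_iff₀ hx]; linarith [Real.pi_pos]

lemma s15F_real (σ : ℝ) (x : ℝ) (hx : 0 < x) (hx2 : x < 2 * π) :
    s15F σ x = ((Real.exp (-(Real.log (8 * Real.pi / x)) ^ σ -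
        (Real.log (8 * Real.pi / (2 * Real.pi - x))) ^ σ) : ℝ) : ℂ) := by
  have hpi := Real.pi_pos
  have h1 : 0 < 2 * π - x := by linarith
  rw [s15F]
  push_cast
  rw [Complex.ofReal_cpow (s15_logpos hx hx2), Complex.ofReal_cpow (s15_logpos h1 (by linarith)),
    Complex.ofReal_log (by positivity), Complex.ofReal_log (by positivity)]
  push_cast
  rfl

lemma s15_young (σ : ℝ) (hσ : 1 < σ) : ∃ A : ℝ, 0 < A ∧ ∀ k L : ℝ, 0 ≤ k → 0 ≤ L →
    k * L ≤ L ^ σ / 2 + A * k ^ (σ / (σ - 1)) := by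
  have hτ : 0 < σ / (σ - 1) := div_pos (by linarith) (by linarith)
  refine ⟨((2:ℝ) ^ (1/σ)) ^ (σ / (σ - 1)) / (σ / (σ - 1)), by positivity, ?_⟩
  intro k L hk hL
  set s : ℝ := (2:ℝ) ^ (1/σ) with hs
  have hs0 : 0 < s := by positivity
  have hsσ : s ^ σ = 2 := by
    rw [hs, ← Real.rpow_mul (by norm_num)]; rw [one_div_mul_cancel (by linarith)]; simp
  have h := Real.young_inequality_of_nonneg (a := L / s) (b := s * k) (by positivity) (by positivity)
    (Real.HolderConjugate.conjExponent hσ)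
  rw [Real.conjExponent, Real.div_rpow hL hs0.le, hsσ, Real.mul_rpow hs0.le hk] at h
  have e1 : L / s * (s * k) = k * L := by field_simp
  have e2 : L ^ σ / 2 / σ ≤ L ^ σ / 2 := div_le_self (by positivity) hσ.le
  rw [e1] at h
  calc _ ≤ _ := h
    _ ≤ L ^ σ / 2 + s ^ (σ / (σ - 1)) * k ^ (σ / (σ - 1)) / (σ / (σ - 1)) := by gcongr
    _ = _ := by ring

/-- Main estimate: analyticity and Cauchy bound. -/
lemma s15_main (σ : ℝ) : ∃ c : ℝ, 0 < c ∧ ∀ x : ℝ, 0 < x → x < 2 * π →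
    AnalyticAt ℂ (s15F σ) x ∧ ∀ n : ℕ, ∀ m : ℝ, m = min x (2 * π - x) →
      ‖iteratedDeriv n (s15F σ) x‖ ≤
        n.factorial * Real.exp (-(Real.log (8 * π / m) ^ σ / 2)) / (c * m) ^ n := by
  obtain ⟨c, hc, hc2, hkey⟩ := s15_key σ
  refine ⟨c, hc, ?_⟩
  intro x hx hx2
  have hx' : 0 < 2 * π - x := by linarith
  have hx2' : 2 * π - x < 2 * π := by linarith
  obtain ⟨m, hm⟩ : ∃ m, m = min x (2 * π - x) := ⟨_, rfl⟩
  have hm0 : 0 < m := by rw [hm]; positivity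
  have hmx : m ≤ x := hm ▸ min_le_left _ _
  have hmx' : m ≤ 2 * π - x := hm ▸ min_le_right _ _
  have hz : ∀ z ∈ Metric.closedBall (x : ℂ) (c * m), DifferentiableAt ℂ (s15F σ) z ∧
      ‖s15F σ z‖ ≤ Real.exp (-(Real.log (8 * π / m) ^ σ / 2)) := by
    intro z hz
    rw [mem_closedBall_iff_norm] at hz
    obtain ⟨a1, a2, a3, a4⟩ := hkey x hx hx2 z (hz.trans (by gcongr))
    obtain ⟨b1, b2, b3, b4⟩ := hkey (2 * π - x) hx' hx2' (2 * π - z) (by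
      push_cast
      rw [show (2 * π - z - (2 * π - x) : ℂ) = -(z - x) by ring, norm_neg]
      exact hz.trans (by gcongr))
    constructor
    · unfold s15F
      apply DifferentiableAt.cexp
      apply DifferentiableAt.sub
      · apply DifferentiableAt.neg
        refine DifferentiableAt.cpow_const (DifferentiableAt.clog ?_ a2) a3
        exact (differentiableAt_const _).div differentiableAt_id a1
      · refine DifferentiableAt.cpow_const (DifferentiableAt.clog ?_ b2) b3
        exact (differentiableAt_const _).div ((differentiableAt_const _).sub differentiableAt_id) b1
    · rw [s15F, Complex.norm_exp]
      apply Real.exp_le_exp.2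
      simp only [Complex.sub_re, Complex.neg_re]
      have p1 : 0 ≤ Real.log (8 * π / x) ^ σ := Real.rpow_nonneg (s15_logpos hx hx2) _
      have p2 : 0 ≤ Real.log (8 * π / (2 * π - x)) ^ σ := Real.rpow_nonneg (s15_logpos hx' hx2') _
      rcases min_choice x (2 * π - x) with h | h
      · rw [hm, h]; linarith
      · rw [hm, h]; linarith
  have hd : DifferentiableOn ℂ (s15F σ) (Metric.closedBall (x : ℂ) (c * m)) :=
    fun z h => (hz z h).1.differentiableWithinAt
  have hr : 0 < c * m := by positivity
  refine ⟨hd.analyticAt (Metric.closedBall_mem_nhds _ hr), ?_⟩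
  intro n m' hm'
  obtain rfl : m' = m := hm'.trans hm.symm
  exact Complex.norm_iteratedDeriv_le_of_forall_mem_sphere_norm_le n hr
    (hd.diffContOnCl_ball subset_rfl) (fun z h => (hz z (Metric.sphere_subset_closedBall h)).2)

/-- weighted bound -/
lemma s15_weight (σ : ℝ) (hσ : 1 < σ) : ∃ A : ℝ, 0 < A ∧ ∀ k : ℕ, ∀ m : ℝ, 0 < m → m < 2 * π →
    Real.exp (-(Real.log (8 * π / m) ^ σ / 2)) ≤ Real.exp (A * (k : ℝ) ^ (σ / (σ - 1))) * m ^ k := by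
  obtain ⟨A, hA, h⟩ := s15_young σ hσ
  refine ⟨A, hA, fun k m hm hm2 => ?_⟩
  have hpi := Real.pi_gt_three
  have h1 := h k (Real.log (8 * π / m)) (by positivity) (s15_logpos hm hm2)
  have h2 : (1 : ℝ) ≤ Real.exp (k * Real.log (8 * π / m)) * m ^ k := by
    rw [Real.exp_nat_mul, Real.exp_log (by positivity), ← mul_pow]
    apply one_le_pow₀
    rw [div_mul_cancel₀ _ hm.ne']; linarith
  calc _ = Real.exp (-(Real.log (8 * π / m) ^ σ / 2)) * 1 := by ring
    _ ≤ Real.exp (-(Real.log (8 * π / m) ^ σ / 2)) *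
        (Real.exp (k * Real.log (8 * π / m)) * m ^ k) := by gcongr
    _ = Real.exp (-(Real.log (8 * π / m) ^ σ / 2) + k * Real.log (8 * π / m)) * m ^ k := by
        rw [Real.exp_add]; ring
    _ ≤ _ := by
        gcongr; linarith

lemma s15_fact (τ : ℝ) (hτ : 1 < τ) (c : ℝ) (hc : 0 < c) : ∃ B : ℝ, 0 < B ∧ ∀ n : ℕ,
    (n.factorial : ℝ) / c ^ n ≤ Real.exp (B * (n : ℝ) ^ τ) := by
  have hτ' : 0 < τ - 1 := by linarith
  refine ⟨1 / (τ - 1) + |Real.log c|, by positivity, fun n => ?_⟩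
  rcases Nat.eq_zero_or_pos n with rfl | hn
  · simp; positivity
  have hn1 : (1 : ℝ) ≤ n := by exact_mod_cast hn
  have hn0 : (0 : ℝ) < n := by linarith
  have e1 : (n.factorial : ℝ) ≤ Real.exp (n * Real.log n) := by
    rw [Real.exp_nat_mul, Real.exp_log hn0]; exact_mod_cast Nat.factorial_le_pow n
  have e2 : (c ^ n)⁻¹ = Real.exp (n * (-Real.log c)) := by
    rw [Real.exp_nat_mul, Real.exp_neg, Real.exp_log hc, inv_pow]
  have e3 : (n : ℝ) ^ τ = n * (n : ℝ) ^ (τ - 1) := by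
    rw [Real.rpow_sub_one hn0.ne']; field_simp
  have e4 : (1 : ℝ) ≤ (n : ℝ) ^ (τ - 1) := Real.one_le_rpow hn1 hτ'.le
  have e5 := Real.log_le_rpow_div hn0.le hτ'
  rw [div_eq_mul_inv, e2]
  calc _ ≤ Real.exp (n * Real.log n) * Real.exp (n * (-Real.log c)) := by gcongr
    _ = Real.exp (n * (Real.log n + (-Real.log c))) := by rw [← Real.exp_add]; ring_nf
    _ ≤ Real.exp (n * ((n : ℝ) ^ (τ - 1) / (τ - 1) + |Real.log c| * (n : ℝ) ^ (τ - 1))) := by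
        gcongr
        exact (neg_le_abs _).trans (le_mul_of_one_le_right (abs_nonneg _) e4)
    _ = _ := by rw [e3]; ring_nf

lemma s15_an {F : ℂ → ℂ} {z : ℂ} (h : AnalyticAt ℂ F z) (n : ℕ) :
    AnalyticAt ℂ (iteratedDeriv n F) z := by
  induction n with
  | zero => simpa using h
  | succ n ih => rw [iteratedDeriv_succ]; exact ih.deriv

lemma s15_hd {F : ℂ → ℂ} {x : ℝ} (h : AnalyticAt ℂ F x) (n : ℕ) :
    HasDerivAt (fun y : ℝ => (iteratedDeriv n F y).re) (iteratedDeriv (n + 1) F x).re x := by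
  rw [iteratedDeriv_succ]
  exact (s15_an h n).differentiableAt.hasDerivAt.real_of_complex

/-- derivatives of a real function agreeing with the extension on an open set -/
lemma s15_eq {F : ℂ → ℂ} {s : Set ℝ} (hs : IsOpen s) (hF : ∀ x ∈ s, AnalyticAt ℂ F (x : ℂ))
    {f : ℝ → ℝ} (hf : ∀ x ∈ s, f x = (F x).re) (n : ℕ) :
    ∀ x ∈ s, iteratedDeriv n f x = (iteratedDeriv n F x).re := by
  induction n with
  | zero => simpa using hf
  | succ n ih =>
    intro x hx
    rw [iteratedDeriv_succ, ← (s15_hd (hF x hx) n).deriv]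
    apply Filter.EventuallyEq.deriv_eq
    filter_upwards [hs.mem_nhds hx] with y hy using ih y hy

/-- For `σ > 1`, the sample function
`φ₀(x) = exp(-(log(8π/x))^σ - (log(8π/(2π-x)))^σ)` on `(0, 2π)` has `n`-th derivatives
bounded by `exp(C n^{σ/(σ-1)})` for an absolute constant `C > 0`; in particular its
`2π`-periodic extension (with value `0` at `0`) is `C^∞` and flat at `0`. -/
theorem statement15 (σ : ℝ) (hσ : 1 < σ)
    (φ₀ : ℝ → ℝ)
    (hφ₀ : ∀ x : ℝ, φ₀ x =
      Real.exp (-(Real.log (8 * Real.pi / x)) ^ σ -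
        (Real.log (8 * Real.pi / (2 * Real.pi - x))) ^ σ)) :
    (∃ C : ℝ, 0 < C ∧ ∀ n : ℕ, ∀ x ∈ Set.Ioo (0 : ℝ) (2 * Real.pi),
      |iteratedDerivWithin n φ₀ (Set.Ioo (0 : ℝ) (2 * Real.pi)) x| ≤
        Real.exp (C * (n : ℝ) ^ (σ / (σ - 1)))) ∧
    (∀ g : ℝ → ℝ, Function.Periodic g (2 * Real.pi) → g 0 = 0 →
      (∀ x ∈ Set.Ioo (0 : ℝ) (2 * Real.pi), g x = φ₀ x) →
      ContDiff ℝ (⊤ : ℕ∞) g ∧ ∀ n : ℕ, iteratedDeriv n g 0 = 0) := by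
  have hpi := Real.pi_pos
  obtain ⟨c, hc, hmain⟩ := s15_main σ
  obtain ⟨A, hA, hw⟩ := s15_weight σ hσ
  have hτ : 1 < σ / (σ - 1) := by rw [lt_div_iff₀ (by linarith)]; linarith
  obtain ⟨B, hB, hfact⟩ := s15_fact (σ / (σ - 1)) hτ c hc
  have han : ∀ x ∈ Set.Ioo (0 : ℝ) (2 * π), AnalyticAt ℂ (s15F σ) (x : ℂ) :=
    fun x hx => (hmain x hx.1 hx.2).1
  have hre : ∀ x ∈ Set.Ioo (0 : ℝ) (2 * π), φ₀ x = (s15F σ x).re := by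
    intro x hx
    rw [s15F_real σ x hx.1 hx.2, Complex.ofReal_re, hφ₀]
  have hbd : ∀ n j : ℕ, ∀ x ∈ Set.Ioo (0 : ℝ) (2 * π), |(iteratedDeriv n (s15F σ) x).re| ≤
      (n.factorial : ℝ) / c ^ n * Real.exp (A * ((n + j : ℕ) : ℝ) ^ (σ / (σ - 1))) *
        (min x (2 * π - x)) ^ j := by
    intro n j x hx
    have hx' : 0 < 2 * π - x := by linarith [hx.2]
    set m := min x (2 * π - x) with hm
    have hx0 := hx.1
    have hm0 : 0 < m := by rw [hm]; positivity
    have hm2 : m < 2 * π := (min_le_left _ _).trans_lt hx.2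
    calc _ ≤ _ := Complex.abs_re_le_norm _
      _ ≤ _ := (hmain x hx.1 hx.2).2 n m hm
      _ ≤ n.factorial * (Real.exp (A * ((n + j : ℕ) : ℝ) ^ (σ / (σ - 1))) * m ^ (n + j))
          / (c * m) ^ n := by
          gcongr
          exact hw (n + j) m hm0 hm2
      _ = _ := by
          rw [mul_pow, pow_add]; field_simp
  constructor
  · refine ⟨A + B, by positivity, ?_⟩
    intro n x hx
    rw [iteratedDerivWithin_of_isOpen isOpen_Ioo hx, s15_eq isOpen_Ioo han hre n x hx]
    have h := hbd n 0 x hx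
    rw [pow_zero, mul_one, add_zero] at h
    calc _ ≤ _ := h
      _ ≤ Real.exp (B * (n : ℝ) ^ (σ / (σ - 1))) * Real.exp (A * (n : ℝ) ^ (σ / (σ - 1))) := by
          gcongr; exact hfact n
      _ = _ := by rw [← Real.exp_add]; ring_nf
  · intro g hg hg0 hgφ
    have hgF : ∀ x ∈ Set.Ioo (0 : ℝ) (2 * π), g x = (s15F σ x).re :=
      fun x hx => (hgφ x hx).trans (hre x hx)
    have hin := fun n => s15_eq isOpen_Ioo han hgF n
    have hper : ∀ n, Function.Periodic (iteratedDeriv n g) (2 * π) := by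
      intro n x
      have h := iteratedDeriv_comp_add_const n g (2 * π)
      rw [show (fun z => g (z + 2 * π)) = g from funext hg] at h
      exact (congrFun h x).symm
    have hstep : ∀ n, iteratedDeriv n g 0 = 0 → HasDerivAt (iteratedDeriv n g) 0 0 := by
      intro n hn
      set K := (n.factorial : ℝ) / c ^ n * Real.exp (A * ((n + 2 : ℕ) : ℝ) ^ (σ / (σ - 1)))
      have hK : 0 ≤ K := by positivity
      have hO : iteratedDeriv n g =O[nhds 0] fun x => x ^ 2 := by
        apply Asymptotics.IsBigO.of_bound K
        filter_upwards [Ioo_mem_nhds (by linarith : -(2 * π) < 0) (by linarith : 0 < 2 * π)] with y hy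
        rw [norm_pow, Real.norm_eq_abs, Real.norm_eq_abs, sq_abs]
        rcases lt_trichotomy y 0 with h | h | h
        · have hm : y + 2 * π ∈ Set.Ioo (0 : ℝ) (2 * π) := ⟨by linarith [hy.1], by linarith⟩
          rw [← hper n y, hin n _ hm]
          apply (hbd n 2 _ hm).trans
          have h5 : min (y + 2 * π) (2 * π - (y + 2 * π)) ≤ -y := (min_le_right _ _).trans (by linarith)
          have h6 : 0 ≤ min (y + 2 * π) (2 * π - (y + 2 * π)) := le_min hm.1.le (by linarith)
          rw [← neg_sq y]
          gcongr
        · rw [h, hn]; simp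
        · have hm : y ∈ Set.Ioo (0 : ℝ) (2 * π) := ⟨h, hy.2⟩
          rw [hin n _ hm]
          apply (hbd n 2 _ hm).trans
          have h6 : 0 ≤ min y (2 * π - y) := le_min hm.1.le (by linarith [hy.2])
          gcongr
          exact min_le_left _ _
      rw [hasDerivAt_iff_isLittleO]
      simp only [hn, sub_zero, smul_zero]
      apply hO.trans_isLittleO
      simpa using (Asymptotics.isLittleO_pow_id (𝕜 := ℝ) (n := 2) (by norm_num))
    have hzero : ∀ n, iteratedDeriv n g 0 = 0 := by
      intro n
      induction n with
      | zero => simpa using hg0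
      | succ n ih => rw [iteratedDeriv_succ]; exact (hstep n ih).deriv
    refine ⟨?_, hzero⟩
    apply contDiff_of_differentiable_iteratedDeriv
    intro n _ x
    have hico : ∀ y ∈ Set.Ico (0 : ℝ) (2 * π), DifferentiableAt ℝ (iteratedDeriv n g) y := by
      intro y hy
      rcases hy.1.eq_or_lt with h | h
      · rw [← h]; exact (hstep n (hzero n)).differentiableAt
      · have hy' : y ∈ Set.Ioo (0 : ℝ) (2 * π) := ⟨h, hy.2⟩
        apply (s15_hd (han y hy') n).differentiableAt.congr_of_eventuallyEq
        filter_upwards [isOpen_Ioo.mem_nhds hy'] with w hw using hin n w hw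
    obtain ⟨k, hk, -⟩ := existsUnique_add_zsmul_mem_Ico (by linarith : (0:ℝ) < 2 * π) x 0
    rw [zero_add] at hk
    have h := hico _ hk
    have hfun : iteratedDeriv n g = fun y => iteratedDeriv n g (y + k • (2 * π)) :=
      funext fun y => ((hper n).zsmul k y).symm
    rw [hfun]
    exact (differentiableAt_comp_add_const).2 h
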